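/- For every simplicial set X, the unnormalized chain complex C(X) — the alternating face map complex of the simplicial abelian group obtained by applying the free abelian group functor levelwise to X — is naturally isomorphic to the normalized chain complex N(𝔡(𝔣(X))), the normalized Moore complex of the levelwise free abelian group on the simplicial set 𝔡(𝔣(X)) obtained by forgetting the degeneracies of X and then freely adjoining new ones. -/

import Mathlib

open CategoryTheory Opposite AlgebraicTopology CategoryTheory.Preadditive

/-- The semisimplex category `Δ₊`: same objects as `SimplexCategory`, but only the
injective (i.e. strictly order-preserving) order-preserving maps. -/
def SemiSimplexCat : Type := SimplexCategory

/-- Interpret an object of `Δ₊` as an object of the simplex category. -/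
def SemiSimplexCat.toSimplex : SemiSimplexCat → SimplexCategory := id

/-- The object `[n]` of `Δ₊`. -/
def SemiSimplexCat.mk (n : ℕ) : SemiSimplexCat := SimplexCategory.mk n

instance : Category SemiSimplexCat where
  Hom a b := { f : a.toSimplex ⟶ b.toSimplex // Function.Injective f.toOrderHom }
  id a := ⟨𝟙 _, fun x y h => by simpa using h⟩
  comp f g := ⟨f.1 ≫ g.1, fun x y h => by
    apply f.2
    apply g.2
    simpa [SimplexCategory.comp_toOrderHom] using h⟩
  id_comp f := by apply Subtype.ext; simp
  comp_id f := by apply Subtype.ext; simp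
  assoc f g h := by apply Subtype.ext; simp

/-- The inclusion of the semisimplex category into the simplex category. -/
def SemiSimplexCat.ι : SemiSimplexCat ⥤ SimplexCategory where
  obj := SemiSimplexCat.toSimplex
  map f := f.1

/-- The `i`-th coface map `[n] ⟶ [n+1]` in the semisimplex category. -/
def SemiSimplexCat.δ {n : ℕ} (i : Fin (n + 2)) :
    SemiSimplexCat.mk n ⟶ SemiSimplexCat.mk (n + 1) :=
  ⟨SimplexCategory.δ i, by
    exact SimplexCategory.mono_iff_injective.mp (inferInstanceAs (Mono (SimplexCategory.δ i)))⟩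

/-- The first simplicial identity in the semisimplex category. -/
theorem SemiSimplexCat.δ_comp_δ'' {n} {i : Fin (n + 3)} {j : Fin (n + 2)}
    (H : i ≤ Fin.castSucc j) :
    δ (i.castLT (Nat.lt_of_le_of_lt (Fin.le_iff_val_le_val.mp H) j.is_lt)) ≫ δ j.succ =
      δ j ≫ δ i :=
  Subtype.ext (SimplexCategory.δ_comp_δ'' H)

/-- The category of semisimplicial sets (delta-complexes): contravariant functors
from `Δ₊` to the category of sets. -/
abbrev SemiSSet : Type 1 := SemiSimplexCatᵒᵖ ⥤ Type

/-- The forgetful functor `𝔣` from simplicial sets to semisimplicial sets,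
given by restriction along `Δ₊ ↪ Δ` (forgetting degeneracy operators). -/
def SemiSSet.f : SSet.{0} ⥤ SemiSSet :=
  (Functor.whiskeringLeft _ _ _).obj SemiSimplexCat.ι.op

/-- The functor `𝔡` freely adjoining degenerate simplices: the left Kan extension
along the inclusion `Δ₊ ↪ Δ`. -/
noncomputable def SemiSSet.d : SemiSSet ⥤ SSet.{0} :=
  SemiSimplexCat.ι.op.lan

namespace SemiSSet

/-- The `i`-th face map of the levelwise free abelian group on a semisimplicial set. -/
noncomputable def face (Y : SemiSSet) {n : ℕ} (i : Fin (n + 2)) :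
    AddCommGrpCat.free.obj (Y.obj (op (SemiSimplexCat.mk (n + 1)))) ⟶
      AddCommGrpCat.free.obj (Y.obj (op (SemiSimplexCat.mk n))) :=
  AddCommGrpCat.free.map (Y.map (SemiSimplexCat.δ i).op)

theorem face_comp'' (Y : SemiSSet) {n} {i : Fin (n + 3)} {j : Fin (n + 2)}
    (H : i ≤ Fin.castSucc j) :
    Y.face j.succ ≫
        Y.face (i.castLT (Nat.lt_of_le_of_lt (Fin.le_iff_val_le_val.mp H) j.is_lt)) =
      Y.face i ≫ Y.face j := by
  dsimp only [face]
  rw [← Functor.map_comp, ← Functor.map_comp, ← Functor.map_comp, ← Functor.map_comp,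
    ← op_comp, ← op_comp, SemiSimplexCat.δ_comp_δ'' H]

/-- The differential of the semisimplicial chain complex: the alternating sum of the
face maps. -/
noncomputable def chainsD (Y : SemiSSet) (n : ℕ) :
    AddCommGrpCat.free.obj (Y.obj (op (SemiSimplexCat.mk (n + 1)))) ⟶
      AddCommGrpCat.free.obj (Y.obj (op (SemiSimplexCat.mk n))) :=
  ∑ i : Fin (n + 2), (-1 : ℤ) ^ (i : ℕ) • Y.face i

theorem chainsD_squared (Y : SemiSSet) (n : ℕ) :
    Y.chainsD (n + 1) ≫ Y.chainsD n = 0 := by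
  dsimp [chainsD]
  simp only [comp_sum, sum_comp, ← Finset.sum_product']
  let P := Fin (n + 2) × Fin (n + 3)
  let S := Finset.univ.filter fun ij : P => (ij.2 : ℕ) ≤ (ij.1 : ℕ)
  erw [← Finset.sum_add_sum_compl S, ← eq_neg_iff_add_eq_zero, ← Finset.sum_neg_distrib]
  let φ : ∀ ij : P, ij ∈ S → P := fun ij hij =>
    (Fin.castLT ij.2 (lt_of_le_of_lt (Finset.mem_filter.mp hij).right (Fin.is_lt ij.1)), ij.1.succ)
  apply Finset.sum_bij φ
  · intro ij hij
    simp only [S, Finset.mem_univ, Finset.compl_filter, Finset.mem_filter, true_and,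
      Fin.val_succ, Fin.val_castLT, φ] at hij ⊢
    linarith
  · rintro ⟨i, j⟩ hij ⟨i', j'⟩ hij' h
    rw [Prod.mk_inj]
    exact ⟨by simpa [φ] using congr_arg Prod.snd h,
      by simpa [φ, Fin.castSucc_castLT] using congr_arg Fin.castSucc (congr_arg Prod.fst h)⟩
  · rintro ⟨i', j'⟩ hij'
    simp only [S, Finset.mem_univ, forall_true_left, Prod.forall, Finset.compl_filter,
      not_le, Finset.mem_filter, true_and] at hij'
    refine ⟨(j'.pred <| ?_, Fin.castSucc i'), ?_, ?_⟩
    · rintro rfl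
      simp only [Fin.val_zero, not_lt_zero] at hij'
    · simpa only [S, Finset.mem_univ, forall_true_left, Prod.forall, Finset.mem_filter,
        Fin.val_castSucc, Fin.val_pred, true_and] using Nat.le_sub_one_of_lt hij'
    · simp only [φ, Fin.castLT_castSucc, Fin.succ_pred]
  · rintro ⟨i, j⟩ hij
    dsimp
    simp only [zsmul_comp, comp_zsmul, smul_smul, ← neg_smul]
    congr 1
    · simp only [φ, Fin.val_succ, pow_add, pow_one, mul_neg, neg_neg, mul_one]
      apply mul_comm
    · rw [face_comp'']
      simpa [S] using! hij

/-- The semisimplicial chain complex of a semisimplicial set `Y`: its group of `n`-chains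
is the free abelian group on `Y_n` and its differential is the alternating sum of the
face maps. -/
noncomputable def chains (Y : SemiSSet) : ChainComplex AddCommGrpCat ℕ :=
  ChainComplex.of (fun n => AddCommGrpCat.free.obj (Y.obj (op (SemiSimplexCat.mk n))))
    Y.chainsD Y.chainsD_squared

/-- The semisimplicial chain complex, as a functor. -/
noncomputable def chainsFunctor : SemiSSet ⥤ ChainComplex AddCommGrpCat ℕ where
  obj := chains
  map {Y Y'} g := ChainComplex.ofHom
    (fun n => AddCommGrpCat.free.map (g.app (op (SemiSimplexCat.mk n))))
    (fun n => by
      simp only [chains, ChainComplex.of_d, chainsD, face]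
      rw [comp_sum, sum_comp]
      refine Finset.sum_congr rfl fun i _ => ?_
      rw [comp_zsmul, zsmul_comp]
      congr 1
      rw [← Functor.map_comp, ← Functor.map_comp, g.naturality])
  map_id Y := by
    ext n : 1
    exact AddCommGrpCat.free.map_id _
  map_comp g h := by
    ext n : 1
    exact AddCommGrpCat.free.map_comp _ _

end SemiSSet

/-- The normalized chain complex functor `N`: the normalized Moore complex of the
levelwise free abelian group on a simplicial set. -/
noncomputable def SSet.normalizedChains : SSet.{0} ⥤ ChainComplex AddCommGrpCat ℕ :=
  ((SimplicialObject.whiskering _ _).obj AddCommGrpCat.free) ⋙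
    normalizedMooreComplex AddCommGrpCat

/-- The unnormalized chain complex functor `C`: the alternating face map complex of the
levelwise free abelian group on a simplicial set. -/
noncomputable def SSet.unnormalizedChains : SSet.{0} ⥤ ChainComplex AddCommGrpCat ℕ :=
  ((SimplicialObject.whiskering _ _).obj AddCommGrpCat.free) ⋙
    alternatingFaceMapComplex AddCommGrpCat


namespace SemiSSet

open Limits SimplicialObject SimplicialObject.Splitting Simplicial

/-- A mono of the simplex category as a morphism of the semisimplex category. -/
def monoHom {K L : SimplexCategory} (m : K ⟶ L) [Mono m] :
    (SemiSimplexCat.mk K.len ⟶ SemiSimplexCat.mk L.len) :=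
  ⟨m, (SimplexCategory.mono_iff_injective (f := m)).mp ‹Mono m›⟩

/-- Normal forms for simplices of `𝔡 Y`. -/
abbrev NF (Y : SemiSSet) (Δ : SimplexCategory) : Type :=
  Σ A : IndexSet (op Δ), Y.obj (op (SemiSimplexCat.mk A.1.unop.len))

/-- The normal form attached to an epi-mono factorization. -/
def nf (Y : SemiSSet) {Δ K L : SimplexCategory} (e : Δ ⟶ K) [Epi e] (m : K ⟶ L) [Mono m]
    (y : Y.obj (op (SemiSimplexCat.mk L.len))) : NF Y Δ :=
  ⟨IndexSet.mk e, Y.map (monoHom m).op y⟩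

theorem nf_unique (Y : SemiSSet) {Δ K K' L : SimplexCategory} (e : Δ ⟶ K) [Epi e]
    (m : K ⟶ L) [Mono m] (e' : Δ ⟶ K') [Epi e'] (m' : K' ⟶ L) [Mono m']
    (h : e ≫ m = e' ≫ m') (y : Y.obj (op (SemiSimplexCat.mk L.len))) :
    nf Y e m y = nf Y e' m' y := by
  have h1 := SimplexCategory.image_eq h
  have h2 := SimplexCategory.image_eq (e := e') (i := m') rfl
  obtain rfl : K = K' := h1.symm.trans h2
  generalize hg : e' ≫ m' = g at h h1 h2
  subst h2
  obtain rfl : m = m' :=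
    (SimplexCategory.image_ι_eq h).symm.trans (SimplexCategory.image_ι_eq hg)
  obtain rfl : e = e' := (cancel_mono m).1 (h.trans hg.symm)
  rfl

/-- The normal form of a generator of the pointwise colimit. -/
noncomputable def toNF (Y : SemiSSet) {Δ L : SimplexCategory} (g : Δ ⟶ L)
    (y : Y.obj (op (SemiSimplexCat.mk L.len))) : NF Y Δ :=
  nf Y (factorThruImage g) (image.ι g) y

theorem toNF_eq (Y : SemiSSet) {Δ K L : SimplexCategory} (e : Δ ⟶ K) [Epi e]
    (m : K ⟶ L) [Mono m] (g : Δ ⟶ L) (h : e ≫ m = g)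
    (y : Y.obj (op (SemiSimplexCat.mk L.len))) :
    toNF Y g y = nf Y e m y :=
  nf_unique Y _ _ _ _ (by simp [h]) y

theorem nf_map (Y : SemiSSet) {Δ K L L' : SimplexCategory} (e : Δ ⟶ K) [Epi e] (m : K ⟶ L)
    [Mono m] (i : L ⟶ L') [Mono i] (y : Y.obj (op (SemiSimplexCat.mk L'.len))) :
    nf Y e m (Y.map (monoHom i).op y) = nf Y e (m ≫ i) y := by
  unfold nf
  rw [← ConcreteCategory.comp_apply, ← Y.map_comp]
  rfl

theorem toNF_map (Y : SemiSSet) {Δ L L' : SimplexCategory} (g : Δ ⟶ L)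
    (i : L ⟶ L') [Mono i] (y : Y.obj (op (SemiSimplexCat.mk L'.len))) :
    toNF Y g (Y.map (monoHom i).op y) = toNF Y (g ≫ i) y := by
  rw [toNF, nf_map, toNF_eq Y (factorThruImage g) (image.ι g ≫ i) (g ≫ i) (by simp)]

theorem mono_of_hom {a b : SemiSimplexCat} (φ : a ⟶ b) : Mono (φ.1) :=
  SimplexCategory.mono_iff_injective.mpr φ.2

/-- The cocone with point the type of normal forms. -/
noncomputable def nfCocone (Y : SemiSSet) (Δ : SimplexCategory) :
    Cocone (CostructuredArrow.proj SemiSimplexCat.ι.op (op Δ) ⋙ Y) where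
  pt := NF Y Δ
  ι :=
    { app := fun g => ↾(fun y => toNF Y (L := g.left.unop.toSimplex) g.hom.unop y)
      naturality := fun g₁ g₂ φ => by
        ext y
        have w := CostructuredArrow.w φ
        have := mono_of_hom φ.left.unop
        have key := @toNF_map Y Δ _ _ g₂.hom.unop (φ.left.unop.1) this y
        refine key.trans ?_
        have w' : g₂.hom.unop ≫ φ.left.unop.1 = g₁.hom.unop := congrArg Quiver.Hom.unop w
        rw [w']
        rfl }

/-- The unit of the left Kan extension. -/
noncomputable abbrev unit (Y : SemiSSet) : Y ⟶ SemiSimplexCat.ι.op ⋙ d.obj Y :=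
  SemiSimplexCat.ι.op.lanUnit.app Y

/-- The pointwise colimit cocone. -/
noncomputable def isColim (Y : SemiSSet) (Δ : SimplexCategory) :
    IsColimit ((Functor.LeftExtension.mk (d.obj Y) (unit Y)).coconeAt (op Δ)) :=
  Functor.isPointwiseLeftKanExtensionOfIsLeftKanExtension (F := Y) _
    (SemiSimplexCat.ι.op.lanUnit.app Y) (op Δ)

/-- The unit on simplices. -/
noncomputable def η (Y : SemiSSet) (n : ℕ) :
    Y.obj (op (SemiSimplexCat.mk n)) ⟶ (d.obj Y) _⦋n⦌ :=
  (unit Y).app (op (SemiSimplexCat.mk n))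

theorem η_map (Y : SemiSSet) {K L : SimplexCategory} (i : K ⟶ L) [Mono i]
    (y : Y.obj (op (SemiSimplexCat.mk L.len))) :
    η Y K.len (Y.map (monoHom i).op y) = (d.obj Y).map i.op (η Y L.len y) :=
  ConcreteCategory.congr_hom ((unit Y).naturality (monoHom i).op) y

theorem d_surj (Y : SemiSSet) (Δ : SimplexCategory) (x : (d.obj Y).obj (op Δ)) :
    ∃ (L : SimplexCategory) (g : Δ ⟶ L) (y : Y.obj (op (SemiSimplexCat.mk L.len))),
      (d.obj Y).map g.op (η Y L.len y) = x := by
  obtain ⟨j, y, h⟩ := Types.jointly_surjective_of_isColimit (isColim Y Δ) x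
  exact ⟨j.left.unop.toSimplex, j.hom.unop, y, h⟩

/-- The normal form of a simplex. -/
noncomputable def dNF (Y : SemiSSet) (Δ : SimplexCategory) :
    (d.obj Y).obj (op Δ) ⟶ NF Y Δ :=
  (isColim Y Δ).desc (nfCocone Y Δ)

theorem dNF_apply (Y : SemiSSet) {Δ L : SimplexCategory} (g : Δ ⟶ L)
    (y : Y.obj (op (SemiSimplexCat.mk L.len))) :
    dNF Y Δ ((d.obj Y).map g.op (η Y L.len y)) = toNF Y g y :=
  ConcreteCategory.congr_hom ((isColim Y Δ).fac (nfCocone Y Δ)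
    (CostructuredArrow.mk (Y := op (SemiSimplexCat.mk L.len)) (f := g.op))) y

theorem dNF_epi (Y : SemiSSet) {Δ L : SimplexCategory} (g : Δ ⟶ L) [Epi g]
    (y : Y.obj (op (SemiSimplexCat.mk L.len))) :
    dNF Y Δ ((d.obj Y).map g.op (η Y L.len y)) = ⟨IndexSet.mk g, y⟩ := by
  rw [dNF_apply, toNF_eq Y g (𝟙 L) g (by simp), nf]
  congr 1
  exact ConcreteCategory.congr_hom (Y.map_id _) y

/-- The splitting of `𝔡 Y`. -/
noncomputable def split (Y : SemiSSet) : Splitting (d.obj Y) where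
  N n := Y.obj (op (SemiSimplexCat.mk n))
  ι n := η Y n
  isColimit' := fun ⟨Δ⟩ ↦ Nonempty.some (by
    rw [Cofan.nonempty_isColimit_iff_bijective_fromSigma]
    constructor
    · refine Function.LeftInverse.injective (g := dNF Y Δ) ?_
      rintro ⟨⟨⟨L⟩, e, he⟩, y⟩
      exact dNF_epi Y (L := L) e y
    · intro x
      obtain ⟨L, g, y, rfl⟩ := d_surj Y Δ x
      refine ⟨toNF Y g y, ?_⟩
      change (d.obj Y).map (factorThruImage g).op
        (η Y (image g).len (Y.map (monoHom (image.ι g)).op y)) = _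
      rw [η_map, ← ConcreteCategory.comp_apply, ← Functor.map_comp, ← op_comp, image.fac])

/-- The splitting of the free simplicial abelian group on `𝔡 Y`. -/
noncomputable def splitFree (Y : SemiSSet) :
    Splitting (((SimplicialObject.whiskering _ _).obj AddCommGrpCat.free).obj (d.obj Y)) :=
  haveI : PreservesColimitsOfSize.{0, 0} AddCommGrpCat.free :=
    AddCommGrpCat.adj.leftAdjoint_preservesColimits
  haveI : PreservesFiniteCoproducts AddCommGrpCat.free := ⟨fun _ => inferInstance⟩
  (split Y).map AddCommGrpCat.free

open DoldKan

section

variable {A : Type*} [Category* A] [Abelian A] {X : SimplicialObject A} (s : Splitting X)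

theorem isIso_aux {C : Type*} [Category* C] {N X M : C} (i : N ⟶ X) (p : X ⟶ M) (q : M ⟶ X)
    (π : X ⟶ N) (P : X ⟶ X) (h1 : p ≫ q = P) (h2 : q ≫ p = 𝟙 _) (h3 : P ≫ π = π)
    (h4 : π ≫ i ≫ P = P) (h5 : i ≫ π = 𝟙 _) : IsIso (i ≫ p) := by
  subst h1
  refine ⟨q ≫ π, ?_, ?_⟩
  · rw [Category.assoc] at h3
    rw [Category.assoc, h3, h5]
  · have := congrArg (fun t => q ≫ t ≫ p) h4
    simpa [h2, reassoc_of% h2] using this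

theorem isIso_ι (n : ℕ) : IsIso (s.ι n ≫ (PInftyToNormalizedMooreComplex X).f n) := by
  have e4 := s.πSummand_comp_cofan_inj_id_comp_PInfty_eq_PInfty n
  have e5 := s.cofan_inj_πSummand_eq_id (IndexSet.id (op ⦋n⦌))
  rw [s.cofan_inj_id] at e4 e5
  exact isIso_aux (s.ι n) ((PInftyToNormalizedMooreComplex X).f n)
    ((inclusionOfMooreComplexMap X).f n) (s.πSummand (IndexSet.id (op ⦋n⦌))) (PInfty.f n)
    (HomologicalComplex.congr_hom
      (PInftyToNormalizedMooreComplex_comp_inclusionOfMooreComplexMap X) n)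
    (HomologicalComplex.congr_hom (splitMonoInclusionOfMooreComplexMap X).id n)
    (s.PInfty_comp_πSummand_id n) e4 e5

theorem sum_aux {C : Type*} [Category* C] [Preadditive C] {X X' Y Y' : C} (a : X ⟶ X')
    (b : Y ⟶ Y') {m : ℕ} (g : Fin m → (X ⟶ Y)) (g' : Fin m → (X' ⟶ Y'))
    (h : ∀ i, a ≫ g' i = g i ≫ b) :
    a ≫ (∑ i : Fin m, (-1 : ℤ) ^ (i : ℕ) • g' i) =
      (∑ i : Fin m, (-1 : ℤ) ^ (i : ℕ) • g i) ≫ b := by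
  rw [comp_sum, sum_comp]
  refine Finset.sum_congr rfl fun i _ => ?_
  rw [comp_zsmul, zsmul_comp, h]

theorem square_aux {C : Type*} [Category* C] {X X' Y Y' Z Z' : C} {a : X ⟶ X'} {b : Y ⟶ Y'}
    {c : Z ⟶ Z'} {u : X ⟶ Y} {u' : X' ⟶ Y'} {v : Y ⟶ Z} {v' : Y' ⟶ Z'}
    (h : a ≫ u' = u ≫ b) (h' : b ≫ v' = v ≫ c) : a ≫ u' ≫ v' = (u ≫ v) ≫ c := by
  rw [reassoc_of% h, h', Category.assoc]

end

/-- The unit on chains. -/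
noncomputable def chainUnit (X : SSet.{0}) :
    SSet.unnormalizedChains.obj X ⟶ SSet.unnormalizedChains.obj (d.obj (f.obj X)) :=
  ChainComplex.ofHom
    (fun n => AddCommGrpCat.free.map (η (f.obj X) n))
    (fun n => by
      simp only [SSet.unnormalizedChains, Functor.comp_obj, alternatingFaceMapComplex_obj_d,
        AlternatingFaceMapComplex.objD]
      refine sum_aux _ _ _ _ fun i => ?_
      refine (AddCommGrpCat.free.map_comp _ _).symm.trans
        (Eq.trans ?_ (AddCommGrpCat.free.map_comp _ _))
      congr 1
      exact ((unit (f.obj X)).naturality (SemiSimplexCat.δ i).op).symm)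

/-- The comparison transformation. -/
noncomputable def comparison :
    SSet.unnormalizedChains ⟶ f ⋙ d ⋙ SSet.normalizedChains where
  app X := chainUnit X ≫ PInftyToNormalizedMooreComplex _
  naturality X X' φ := by
    have h : SSet.unnormalizedChains.map φ ≫ chainUnit X' =
        chainUnit X ≫ SSet.unnormalizedChains.map (d.map (f.map φ)) := by
      ext n : 1
      refine (AddCommGrpCat.free.map_comp _ _).symm.trans
        (Eq.trans ?_ (AddCommGrpCat.free.map_comp _ _))
      congr 1
      exact congrArg (fun t => NatTrans.app t (op (SemiSimplexCat.mk n)))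
        (SemiSimplexCat.ι.op.lanUnit.naturality (f.map φ))
    exact square_aux h (PInftyToNormalizedMooreComplex_naturality _)

theorem isIso_comparison_app (X : SSet.{0}) : IsIso (comparison.app X) := by
  have : ∀ n, IsIso ((comparison.app X).f n) := fun n => isIso_ι (splitFree (f.obj X)) n
  exact HomologicalComplex.Hom.isIso_of_components _

end SemiSSet

/-- For every simplicial set `X`, the unnormalized chain complex `C(X)` is naturally
isomorphic to the normalized chain complex `N(𝔡(𝔣(X)))` of the simplicial set obtained by
forgetting the degeneracies of `X` and freely adjoining new ones. -/
theorem unnormalizedChains_iso_normalizedChains_d_f :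
    Nonempty (SSet.unnormalizedChains ≅ SemiSSet.f ⋙ SemiSSet.d ⋙ SSet.normalizedChains) := by
  have := SemiSSet.isIso_comparison_app
  have : IsIso SemiSSet.comparison := NatIso.isIso_of_isIso_app _
  exact ⟨asIso SemiSSet.comparison⟩
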